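/- arXiv:2211.02859 — 2 statements merged into one kernel-verified Lean document; each statement's English description precedes it below -/
import Mathlib

section
/- Let V be a weak lower perfect space with lower perfect basis B. For any (i,l) ∈ I^∞ and n ∈ ℤ_{≥0}, the image of the set {b + 𝚏_{il}^{n+1}V : b ∈ B, d_{il}(b) = n} under the canonical projection is a basis of the quotient vector space 𝚏_{il}^n V / 𝚏_{il}^{n+1} V. -/
noncomputable section

open Function Set

/-- An even symmetrizable Borcherds–Cartan datum: a countable index set `I`, an
even symmetrizable Borcherds–Cartan matrix `a`, a symmetrizing diagonal `s`,
a free abelian weight lattice `P` and linearly independent simple roots `α`. -/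
structure BCDatum (I : Type*) (P : Type*) [AddCommGroup P] where
  a : I → I → ℤ
  s : I → ℤ
  α : I → P
  countable_index : Countable I
  even_diag : ∀ i, Even (a i i)
  diag_le_two : ∀ i, a i i ≤ 2
  offdiag_nonpos : ∀ i j, i ≠ j → a i j ≤ 0
  s_pos : ∀ i, 0 < s i
  symmetrizable : ∀ i j, s i * a i j = s j * a j i
  free_weight : Module.Free ℤ P
  roots_indep : LinearIndependent ℤ α

namespace BCDatum

variable {I P : Type*} [AddCommGroup P] (D : BCDatum I P)

/-- `I^∞ = I^re ⊔ (I^im × ℤ_{>0})`. -/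
abbrev Iinf : Type _ := {i : I // D.a i i = 2} ⊕ ({i : I // D.a i i ≤ 0} × ℕ+)

/-- The weight `l·α_i` attached to an element of `I^∞` (with `l = 1` in the real case). -/
def wtOf (x : D.Iinf) : P :=
  Sum.elim (fun i => D.α i.1) (fun p => (p.2 : ℕ) • D.α p.1.1) x

/-- `R_+ = Σ_i ℤ_{≥0} α_i`. -/
def Rplus : Set P := {μ | ∃ c : I →₀ ℕ, μ = c.sum fun i n => n • D.α i}

end BCDatum

/-- A good sequence of indices: every element of `I^∞` appears infinitely often. -/
def GoodIdxSeq {I P : Type*} [AddCommGroup P] {D : BCDatum I P} (gi : ℕ → D.Iinf) : Prop :=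
  ∀ x : D.Iinf, ∀ N : ℕ, ∃ n, N ≤ n ∧ gi n = x

/-- Lexicographic strict order on integer sequences: `SeqLt a b` means `a < b`. -/
def SeqLt (a b : ℕ → ℕ) : Prop := ∃ m, (∀ s, s < m → a s = b s) ∧ a m < b m

/-- Lexicographic order: `SeqLe a b` means `a ≤ b`. -/
def SeqLe (a b : ℕ → ℕ) : Prop := a = b ∨ SeqLt a b

/-- A good sequence of nonnegative integers: eventually zero. -/
def GoodNatSeq (a : ℕ → ℕ) : Prop := ∃ N, ∀ n, N ≤ n → a n = 0

/-- A weak lower perfect space over a Borcherds–Cartan datum `D`: a `P`-graded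
`k`-vector space with finite dimensional weight spaces, weights bounded by
finitely many `λ_j - R_+`, together with endomorphisms `f x = 𝚏_{il}`
lowering the weight by `l·α_i`. -/
structure WeakLowerPerfect {I P : Type*} [AddCommGroup P] (D : BCDatum I P)
    (k : Type*) [Field k] (V : Type*) [AddCommGroup V] [Module k V] where
  wtSp : P → Submodule k V
  wt_indep : iSupIndep wtSp
  wt_total : ⨆ μ, wtSp μ = ⊤
  wt_findim : ∀ μ, FiniteDimensional k (wtSp μ)
  wt_bdd : ∃ Λ : Finset P, ∀ μ, wtSp μ ≠ ⊥ → ∃ lam ∈ Λ, ∃ β ∈ D.Rplus, μ = lam - β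
  f : D.Iinf → Module.End k V
  f_wt : ∀ x μ, ∀ v ∈ wtSp μ, f x v ∈ wtSp (μ - D.wtOf x)

namespace WeakLowerPerfect

variable {I P : Type*} [AddCommGroup P] {D : BCDatum I P}
  {k : Type*} [Field k] {V : Type*} [AddCommGroup V] [Module k V]

/-- `d_{il}(v)`: the largest `n` with `v ∈ 𝚏_{il}^n V` (for `v ≠ 0` in a weak
lower perfect space this is the unique `n` with `v ∈ 𝚏^n V \ 𝚏^{n+1} V`). -/
def d (W : WeakLowerPerfect D k V) (x : D.Iinf) (v : V) : ℕ :=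
  sSup {n | v ∈ LinearMap.range (W.f x ^ n)}

/-- The composite `𝚏_{i_1l_1}^{a_1} ⋯ 𝚏_{i_rl_r}^{a_r}` (`0`-based indexing). -/
def prodF (W : WeakLowerPerfect D k V) (gi : ℕ → D.Iinf) (a : ℕ → ℕ) (r : ℕ) :
    Module.End k V :=
  ((List.range r).map fun j => W.f (gi j) ^ a j).prod

/-- `V^{>𝐢,𝐚} = Σ_{k=1}^r 𝚏_{i_1l_1}^{a_1}⋯𝚏_{i_{k-1}l_{k-1}}^{a_{k-1}} 𝚏_{i_kl_k}^{a_k+1} V`. -/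
def Vgt (W : WeakLowerPerfect D k V) (gi : ℕ → D.Iinf) (a : ℕ → ℕ) (r : ℕ) :
    Submodule k V :=
  ⨆ j ∈ Finset.range r, LinearMap.range (W.prodF gi a j * W.f (gi j) ^ (a j + 1))

/-- `V^{≥𝐢,𝐚} = V^{>𝐢,𝐚} + 𝚏_{i_1l_1}^{a_1}⋯𝚏_{i_rl_r}^{a_r} V`. -/
def Vge (W : WeakLowerPerfect D k V) (gi : ℕ → D.Iinf) (a : ℕ → ℕ) (r : ℕ) :
    Submodule k V :=
  W.Vgt gi a r ⊔ LinearMap.range (W.prodF gi a r)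

end WeakLowerPerfect

/-- A lower perfect basis of a weak lower perfect space: a basis compatible with the
grading, equipped with crystal-type maps `𝐟_{il} : B → B ∪ {0}` approximating the
`𝚏_{il}` modulo `𝚏_{il}^{d_{il}(b)+2} V`, jointly injective. (The maps `flo` are
extended to all of `V`, with the convention `flo x 0 = 0`.) -/
structure LowerPerfectBasis {I P : Type*} [AddCommGroup P] {D : BCDatum I P}
    {k : Type*} [Field k] {V : Type*} [AddCommGroup V] [Module k V]
    (W : WeakLowerPerfect D k V) where
  B : Set V
  linIndep : LinearIndependent k (Subtype.val : B → V)
  spans : Submodule.span k B = ⊤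
  graded : ∀ b ∈ B, ∃ μ, b ∈ W.wtSp μ
  flo : D.Iinf → V → V
  flo_mem : ∀ x, ∀ b ∈ B, flo x b ∈ B ∨ flo x b = 0
  flo_zero : ∀ x, flo x 0 = 0
  flo_approx : ∀ x, ∀ b ∈ B, ∃ c : k, c ≠ 0 ∧
    W.f x b - c • flo x b ∈ LinearMap.range (W.f x ^ (W.d x b + 2))
  flo_joint_inj : ∀ b ∈ B, ∀ b' ∈ B, (∀ x, flo x b = flo x b') → b = b'

namespace LowerPerfectBasis

variable {I P : Type*} [AddCommGroup P] {D : BCDatum I P}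
  {k : Type*} [Field k] {V : Type*} [AddCommGroup V] [Module k V]
  {W : WeakLowerPerfect D k V}

open Classical in
/-- `𝐞_{il} : B → B ∪ {0}`: `𝐞_{il}(b) = b'` if `b = 𝐟_{il}(b')` with `b' ∈ B`,
and `𝐞_{il}(b) = 0` otherwise. -/
def elo (L : LowerPerfectBasis W) (x : D.Iinf) (b : V) : V :=
  if h : b ∈ L.B ∧ ∃ b' ∈ L.B, L.flo x b' = b then h.2.choose else 0

/-- `𝐞_{il}^{top}(b) = 𝐞_{il}^{d_{il}(b)}(b)`. -/
def etop (L : LowerPerfectBasis W) (x : D.Iinf) (b : V) : V :=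
  (L.elo x)^[W.d x b] b

/-- The sequence `b_0 = b`, `b_{k+1} = 𝐞_{i_{k+1}l_{k+1}}^{top}(b_k)` (0-based). -/
def bseq (L : LowerPerfectBasis W) (gi : ℕ → D.Iinf) (b : V) (n : ℕ) : V :=
  Nat.rec (motive := fun _ => V) b (fun m prev => L.etop (gi m) prev) n

/-- The sequence `𝐝(𝐢,b)`: `d_k = d_{i_kl_k}(b_{k-1})` (0-based). -/
def dseq (L : LowerPerfectBasis W) (gi : ℕ → D.Iinf) (b : V) (n : ℕ) : ℕ :=
  W.d (gi n) (L.bseq gi b n)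

/-- The highest core `B_H = {b ∈ B : d_{il}(b) = 0 for all (i,l)}`. -/
def BH (L : LowerPerfectBasis W) : Set V := {b ∈ L.B | ∀ x, W.d x b = 0}

/-- The iterated crystal map `𝐟_{i_1l_1}^{a_1} ⋯ 𝐟_{i_rl_r}^{a_r}` (0-based). -/
def floSeq (L : LowerPerfectBasis W) (gi : ℕ → D.Iinf) (a : ℕ → ℕ) (r : ℕ) : V → V :=
  Nat.rec (motive := fun _ => V → V) id
    (fun n F => fun b => F ((L.flo (gi n))^[a n] b)) r

/-- The iterated crystal map `𝐞_{i_rl_r}^{a_r} ⋯ 𝐞_{i_1l_1}^{a_1}` (0-based). -/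
def eloSeq (L : LowerPerfectBasis W) (gi : ℕ → D.Iinf) (a : ℕ → ℕ) (r : ℕ) : V → V :=
  Nat.rec (motive := fun _ => V → V) id
    (fun n F => fun b => (L.elo (gi n))^[a n] (F b)) r

end LowerPerfectBasis

/-- A weak upper perfect space: like a weak lower perfect space, but the
endomorphisms `e x = 𝚎_{il}` raise the weight by `l·α_i`. -/
structure WeakUpperPerfect {I P : Type*} [AddCommGroup P] (D : BCDatum I P)
    (k : Type*) [Field k] (V : Type*) [AddCommGroup V] [Module k V] where
  wtSp : P → Submodule k V
  wt_indep : iSupIndep wtSp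
  wt_total : ⨆ μ, wtSp μ = ⊤
  wt_findim : ∀ μ, FiniteDimensional k (wtSp μ)
  wt_bdd : ∃ Λ : Finset P, ∀ μ, wtSp μ ≠ ⊥ → ∃ lam ∈ Λ, ∃ β ∈ D.Rplus, μ = lam - β
  e : D.Iinf → Module.End k V
  e_wt : ∀ x μ, ∀ v ∈ wtSp μ, e x v ∈ wtSp (μ + D.wtOf x)

namespace WeakUpperPerfect

variable {I P : Type*} [AddCommGroup P] {D : BCDatum I P}
  {k : Type*} [Field k] {V : Type*} [AddCommGroup V] [Module k V]

/-- `d^∨_{il}(v) = max{n ≥ 0 : 𝚎_{il}^n v ≠ 0}`. -/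
def dv (W : WeakUpperPerfect D k V) (x : D.Iinf) (v : V) : ℕ :=
  sSup {n | (W.e x ^ n) v ≠ 0}

end WeakUpperPerfect

/-- An upper perfect basis of a weak upper perfect space. -/
structure UpperPerfectBasis {I P : Type*} [AddCommGroup P] {D : BCDatum I P}
    {k : Type*} [Field k] {V : Type*} [AddCommGroup V] [Module k V]
    (W : WeakUpperPerfect D k V) where
  B : Set V
  linIndep : LinearIndependent k (Subtype.val : B → V)
  spans : Submodule.span k B = ⊤
  graded : ∀ b ∈ B, ∃ μ, b ∈ W.wtSp μ
  Elo : D.Iinf → V → V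
  Elo_zero : ∀ x, ∀ b ∈ B, W.dv x b = 0 → Elo x b = 0
  Elo_mem : ∀ x, ∀ b ∈ B, 0 < W.dv x b → Elo x b ∈ B
  Elo_approx : ∀ x, ∀ b ∈ B, 0 < W.dv x b → ∃ c : k, c ≠ 0 ∧
    W.e x b - c • Elo x b ∈ LinearMap.ker (W.e x ^ (W.dv x b - 1))
  Elo_joint_inj : ∀ b ∈ B, ∀ b' ∈ B, (∀ x, Elo x b = Elo x b') → b = b'

/-- A bilinear pairing realizing `V'` as the graded dual of the weak lower perfect
space `V`, with `𝚎_{il}` adjoint to `𝚏_{il}`. -/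
structure IsGradedDualPair {I P : Type*} [AddCommGroup P] {D : BCDatum I P}
    {k : Type*} [Field k] {V V' : Type*} [AddCommGroup V] [Module k V]
    [AddCommGroup V'] [Module k V']
    (W : WeakLowerPerfect D k V) (W' : WeakUpperPerfect D k V')
    (pr : V →ₗ[k] V' →ₗ[k] k) : Prop where
  orth : ∀ μ ν, μ ≠ ν → ∀ u ∈ W.wtSp μ, ∀ v ∈ W'.wtSp ν, pr u v = 0
  nondeg : ∀ μ, ∀ v ∈ W'.wtSp μ, (∀ u ∈ W.wtSp μ, pr u v = 0) → v = 0
  onto_dual : ∀ μ, ∀ φ : Module.Dual k (W.wtSp μ), ∃ v ∈ W'.wtSp μ,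
      ∀ u : W.wtSp μ, pr (↑u) v = φ u
  adjoint : ∀ x (u : V) (v : V'), pr u (W'.e x v) = pr (W.f x u) v

open Classical in
/-- `dB` sends each `b ∈ B` to the corresponding dual basis vector `b^∨`
(characterized by `⟨b'', b^∨⟩ = δ_{b'' b}` and living in the dual weight space). -/
def IsDualFamily {I P : Type*} [AddCommGroup P] {D : BCDatum I P}
    {k : Type*} [Field k] {V V' : Type*} [AddCommGroup V] [Module k V]
    [AddCommGroup V'] [Module k V']
    (W : WeakLowerPerfect D k V) (W' : WeakUpperPerfect D k V')
    (pr : V →ₗ[k] V' →ₗ[k] k) (B : Set V) (dB : V → V') : Prop :=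
  (∀ b ∈ B, ∀ b' ∈ B, pr b' (dB b) = if b' = b then (1 : k) else 0) ∧
  (∀ b ∈ B, ∀ μ, b ∈ W.wtSp μ → dB b ∈ W'.wtSp μ)


namespace BCDatum

variable {I P : Type*} [AddCommGroup P] (D : BCDatum I P)

/-- For `x = (i, l)`, only finitely many multiples `m l α_i` can be subtracted from a
given weight without leaving `R_+`. -/
theorem exists_bound_of_eq_nsmul_add (x : D.Iinf) (ν : P) :
    ∃ N : ℕ, ∀ m : ℕ, ∀ β ∈ D.Rplus, ν = m • D.wtOf x + β → m ≤ N := by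
  classical
  obtain ⟨i, l, hl, hw⟩ : ∃ i : I, ∃ l : ℕ, 0 < l ∧ D.wtOf x = l • D.α i := by
    rcases x with i | p
    · exact ⟨i.1, 1, one_pos, by simp [wtOf]⟩
    · exact ⟨p.1.1, p.2, p.2.pos, rfl⟩
  have key : ∀ m : ℕ, ∀ β ∈ D.Rplus, ν = m • D.wtOf x + β → ∃ c : I →₀ ℤ,
      Finsupp.linearCombination ℤ D.α c = ν ∧ (m : ℤ) ≤ c i := by
    rintro m β ⟨c, rfl⟩ h
    refine ⟨Finsupp.single i ((m * l : ℕ) : ℤ) +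
      c.mapRange (fun n : ℕ => (n : ℤ)) Nat.cast_zero, ?_, ?_⟩
    · rw [map_add, Finsupp.linearCombination_single, h, hw, Finsupp.linearCombination_apply,
        Finsupp.sum_mapRange_index (by simp)]
      simp only [natCast_zsmul, mul_smul]
    · have : m ≤ m * l := Nat.le_mul_of_pos_right m hl
      simp only [Finsupp.add_apply, Finsupp.single_eq_same, Finsupp.mapRange_apply]
      omega
  by_cases hc : ∃ c, Finsupp.linearCombination ℤ D.α c = ν
  · obtain ⟨c, hc⟩ := hc
    refine ⟨(c i).toNat, fun m β hβ h => ?_⟩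
    obtain ⟨c', hc', hm⟩ := key m β hβ h
    have : c' = c := D.roots_indep (hc'.trans hc.symm)
    subst this
    omega
  · exact ⟨0, fun m β hβ h => (hc ((key m β hβ h).imp fun _ h => h.1)).elim⟩

end BCDatum

namespace WeakLowerPerfect

variable {I P : Type*} [AddCommGroup P] {D : BCDatum I P}
  {k : Type*} [Field k] {V : Type*} [AddCommGroup V] [Module k V]
  (W : WeakLowerPerfect D k V)

theorem exists_wtSp_eq_bot (x : D.Iinf) (μ : P) :
    ∃ N : ℕ, ∀ m, N < m → W.wtSp (μ + m • D.wtOf x) = ⊥ := by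
  obtain ⟨Λ, hΛ⟩ := W.wt_bdd
  choose N hN using fun lam => D.exists_bound_of_eq_nsmul_add x (lam - μ)
  refine ⟨Λ.sup N, fun m hm => ?_⟩
  by_contra hne
  obtain ⟨lam, hlam, β, hβ, h⟩ := hΛ _ hne
  have hle : m ≤ N lam := hN lam m β hβ (by
    rw [eq_sub_iff_add_eq] at h
    rw [← h]; abel)
  exact absurd (hle.trans (Finset.le_sup hlam)) (not_le.mpr hm)

open Classical in
/-- The decomposition of `V` into its weight spaces. -/
@[reducible] def decomposition : DirectSum.Decomposition W.wtSp :=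
  ((DirectSum.isInternal_submodule_iff_iSupIndep_and_iSup_eq_top _).2
    ⟨W.wt_indep, W.wt_total⟩).chooseDecomposition

open Classical in
/-- The projection of `V` onto the weight space of weight `μ`. -/
def wtProj (μ : P) : V →ₗ[k] V :=
  letI := W.decomposition
  (W.wtSp μ).subtype ∘ₗ DirectSum.component k P (fun ν => W.wtSp ν) μ ∘ₗ
    (DirectSum.decomposeLinearEquiv W.wtSp).toLinearMap

theorem wtProj_mem (μ : P) (v : V) : W.wtProj μ v ∈ W.wtSp μ := Subtype.property _

theorem wtProj_of_mem {μ : P} {v : V} (hv : v ∈ W.wtSp μ) : W.wtProj μ v = v := by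
  classical
  let := W.decomposition
  exact DirectSum.decompose_of_mem_same W.wtSp hv

theorem wtProj_of_mem_of_ne {μ ν : P} {v : V} (hv : v ∈ W.wtSp μ) (h : μ ≠ ν) :
    W.wtProj ν v = 0 := by
  classical
  let := W.decomposition
  exact DirectSum.decompose_of_mem_ne W.wtSp hv h

theorem mem_of_forall_wtProj_mem {S : Submodule k V} {v : V} (h : ∀ μ, W.wtProj μ v ∈ S) :
    v ∈ S := by
  classical
  let := W.decomposition
  rw [← DirectSum.sum_support_decompose W.wtSp v]
  exact S.sum_mem fun μ _ => h μ

theorem wtProj_f (x : D.Iinf) (μ : P) (v : V) :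
    W.wtProj μ (W.f x v) = W.f x (W.wtProj (μ + D.wtOf x) v) := by
  have hv : v ∈ ⨆ ν, W.wtSp ν := W.wt_total ▸ Submodule.mem_top
  induction hv using Submodule.iSup_induction' with
  | zero => simp
  | add u w _ _ hu hw => simp only [map_add, hu, hw]
  | mem ν u hu =>
    by_cases h : ν = μ + D.wtOf x
    · subst h
      rw [W.wtProj_of_mem hu, W.wtProj_of_mem (by simpa using W.f_wt x _ u hu)]
    · rw [W.wtProj_of_mem_of_ne hu h, map_zero,
        W.wtProj_of_mem_of_ne (W.f_wt x ν u hu) (fun h' => h (sub_eq_iff_eq_add.mp h'))]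

theorem wtProj_f_pow (x : D.Iinf) (m : ℕ) (μ : P) (v : V) :
    W.wtProj μ ((W.f x ^ m) v) = (W.f x ^ m) (W.wtProj (μ + m • D.wtOf x) v) := by
  induction m generalizing v with
  | zero => simp
  | succ m ih =>
    rw [pow_succ, Module.End.mul_apply, ih, wtProj_f, Module.End.mul_apply, succ_nsmul, add_assoc]

theorem exists_wtProj_eq_zero (x : D.Iinf) (μ : P) :
    ∃ N : ℕ, ∀ m, N < m → ∀ v ∈ LinearMap.range (W.f x ^ m), W.wtProj μ v = 0 := by
  obtain ⟨N, hN⟩ := W.exists_wtSp_eq_bot x μ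
  refine ⟨N, fun m hm => ?_⟩
  rintro _ ⟨u, rfl⟩
  have h := W.wtProj_mem (μ + m • D.wtOf x) u
  rw [hN m hm, Submodule.mem_bot] at h
  rw [wtProj_f_pow, h, map_zero]

theorem range_f_pow_antitone (x : D.Iinf) :
    Antitone fun m => LinearMap.range (W.f x ^ m) := by
  refine antitone_nat_of_succ_le fun m => ?_
  rintro _ ⟨u, rfl⟩
  exact ⟨W.f x u, by rw [pow_succ, Module.End.mul_apply]⟩

theorem bddAbove_of_ne_zero (x : D.Iinf) {v : V} (hv : v ≠ 0) :
    BddAbove {m | v ∈ LinearMap.range (W.f x ^ m)} := by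
  obtain ⟨μ, hμ⟩ : ∃ μ, W.wtProj μ v ≠ 0 := by
    by_contra! h
    exact hv ((Submodule.mem_bot k).1 (W.mem_of_forall_wtProj_mem fun μ => by simp [h μ]))
  obtain ⟨N, hN⟩ := W.exists_wtProj_eq_zero x μ
  exact ⟨N, fun m hm => not_lt.1 fun h => hμ (hN m h v hm)⟩

theorem le_d_iff (x : D.Iinf) {v : V} (hv : v ≠ 0) {n : ℕ} :
    n ≤ W.d x v ↔ v ∈ LinearMap.range (W.f x ^ n) := by
  refine ⟨fun h => W.range_f_pow_antitone x h ?_, fun h => le_csSup (W.bddAbove_of_ne_zero x hv) h⟩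
  exact Nat.sSup_mem (s := {m | v ∈ LinearMap.range (W.f x ^ m)})
    ⟨0, v, by simp⟩ (W.bddAbove_of_ne_zero x hv)

end WeakLowerPerfect

namespace LowerPerfectBasis

variable {I P : Type*} [AddCommGroup P] {D : BCDatum I P}
  {k : Type*} [Field k] {V : Type*} [AddCommGroup V] [Module k V]
  {W : WeakLowerPerfect D k V} (L : LowerPerfectBasis W)

theorem ne_zero_of_mem {b : V} (hb : b ∈ L.B) : b ≠ 0 :=
  L.linIndep.ne_zero (⟨b, hb⟩ : L.B)

theorem mem_span_sup_range {x : D.Iinf} {b : V} (hb : b ∈ L.B) {n : ℕ}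
    (h : b ∈ LinearMap.range (W.f x ^ n)) :
    b ∈ Submodule.span k {b | b ∈ L.B ∧ W.d x b = n} ⊔ LinearMap.range (W.f x ^ (n + 1)) := by
  rcases ((W.le_d_iff x (L.ne_zero_of_mem hb)).2 h).eq_or_lt with hd | hd
  · exact Submodule.mem_sup_left (Submodule.subset_span ⟨hb, hd.symm⟩)
  · exact Submodule.mem_sup_right ((W.le_d_iff x (L.ne_zero_of_mem hb)).1 hd)

theorem range_f_pow_eq_span_sup (x : D.Iinf) (n : ℕ) :
    LinearMap.range (W.f x ^ n) =
      Submodule.span k {b | b ∈ L.B ∧ W.d x b = n} ⊔ LinearMap.range (W.f x ^ (n + 1)) := by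
  refine le_antisymm ?_ (sup_le (Submodule.span_le.2 ?_) (W.range_f_pow_antitone x n.le_succ))
  · induction n with
    | zero =>
      rw [pow_zero, Module.End.one_eq_id, LinearMap.range_id, ← L.spans, Submodule.span_le]
      exact fun b hb => L.mem_span_sup_range hb ⟨b, by simp⟩
    | succ n ih =>
      have hrange (m : ℕ) : LinearMap.range (W.f x ^ (m + 1)) =
          (LinearMap.range (W.f x ^ m)).map (W.f x) := by
        rw [pow_succ', Module.End.mul_eq_comp, LinearMap.range_comp]
      rw [hrange n]
      refine (Submodule.map_mono ih).trans ?_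
      rw [Submodule.map_sup, ← hrange (n + 1), Submodule.map_span, sup_le_iff, Submodule.span_le]
      refine ⟨?_, le_sup_right⟩
      rintro _ ⟨b, ⟨hb, hd⟩, rfl⟩
      obtain ⟨c, hc, hmem⟩ := L.flo_approx x b hb
      rw [hd] at hmem
      have hfb : W.f x b ∈ LinearMap.range (W.f x ^ (n + 1)) := by
        rw [hrange n]
        exact Submodule.mem_map_of_mem ((W.le_d_iff x (L.ne_zero_of_mem hb)).1 hd.ge)
      have hflo : L.flo x b ∈ LinearMap.range (W.f x ^ (n + 1)) := by
        rw [← Submodule.smul_mem_iff _ hc, ← sub_sub_cancel (W.f x b) (c • L.flo x b)]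
        exact Submodule.sub_mem _ hfb (W.range_f_pow_antitone x (n + 1).le_succ hmem)
      rw [SetLike.mem_coe, ← sub_add_cancel (W.f x b) (c • L.flo x b)]
      refine Submodule.add_mem _ (Submodule.mem_sup_right hmem) (Submodule.smul_mem _ c ?_)
      rcases L.flo_mem x b hb with h | h
      · exact L.mem_span_sup_range h hflo
      · rw [h]
        exact Submodule.zero_mem _
  · rintro b ⟨hb, hd⟩
    exact (W.le_d_iff x (L.ne_zero_of_mem hb)).1 hd.ge

theorem wtProj_mem_span {S : Set V} (hS : S ⊆ L.B) (μ : P) {v : V}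
    (hv : v ∈ Submodule.span k S) : W.wtProj μ v ∈ Submodule.span k S := by
  refine (Submodule.span_le (p := (Submodule.span k S).comap (W.wtProj μ))).2 (fun b hb => ?_) hv
  obtain ⟨ν, hν⟩ := L.graded b (hS hb)
  rw [SetLike.mem_coe, Submodule.mem_comap]
  rcases eq_or_ne ν μ with rfl | h
  · rw [W.wtProj_of_mem hν]
    exact Submodule.subset_span hb
  · rw [W.wtProj_of_mem_of_ne hν h]
    exact Submodule.zero_mem _

theorem range_f_pow_le_span (x : D.Iinf) (n : ℕ) :
    LinearMap.range (W.f x ^ n) ≤ Submodule.span k {b | b ∈ L.B ∧ n ≤ W.d x b} := by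
  have approx (m : ℕ) : LinearMap.range (W.f x ^ n) ≤
      Submodule.span k {b | b ∈ L.B ∧ n ≤ W.d x b} ⊔ LinearMap.range (W.f x ^ (n + m)) := by
    induction m with
    | zero => exact le_sup_right
    | succ m ih =>
      rw [L.range_f_pow_eq_span_sup x (n + m), ← sup_assoc] at ih
      refine ih.trans (sup_le_sup (sup_le le_rfl (Submodule.span_mono ?_)) le_rfl)
      rintro b ⟨hb, hd⟩
      exact ⟨hb, by omega⟩
  refine fun v hv => W.mem_of_forall_wtProj_mem fun μ => ?_
  obtain ⟨N, hN⟩ := W.exists_wtProj_eq_zero x μ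
  obtain ⟨s, hs, t, ht, rfl⟩ := Submodule.mem_sup.1 (approx (N + 1) hv)
  rw [map_add, hN _ (by omega) t ht, add_zero]
  exact L.wtProj_mem_span (fun b hb => hb.1) μ hs

end LowerPerfectBasis

/-- the image of `{b ∈ B : d_{il}(b) = n}` is a basis of
`𝚏_{il}^n V / 𝚏_{il}^{n+1} V` (realized inside `V / 𝚏_{il}^{n+1} V`). -/
theorem statement4 {I P : Type*} [AddCommGroup P] {D : BCDatum I P}
    {k V : Type*} [Field k] [AddCommGroup V] [Module k V]
    (W : WeakLowerPerfect D k V) (L : LowerPerfectBasis W)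
    (x : D.Iinf) (n : ℕ) :
    LinearIndependent k
      (Subtype.val :
        ((LinearMap.range (W.f x ^ (n + 1))).mkQ '' {b | b ∈ L.B ∧ W.d x b = n} :
          Set (V ⧸ LinearMap.range (W.f x ^ (n + 1)))) →
        V ⧸ LinearMap.range (W.f x ^ (n + 1))) ∧
    Submodule.span k
        ((LinearMap.range (W.f x ^ (n + 1))).mkQ '' {b | b ∈ L.B ∧ W.d x b = n}) =
      Submodule.map (LinearMap.range (W.f x ^ (n + 1))).mkQ
        (LinearMap.range (W.f x ^ n)) := by
  refine ⟨?_, ?_⟩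
  · have hB : LinearIndepOn k id L.B := L.linIndep
    refine LinearIndepOn.id_image (s := {b | b ∈ L.B ∧ W.d x b = n}) ?_
    refine (hB.mono fun b hb => hb.1).map ?_
    rw [Submodule.ker_mkQ]
    refine Disjoint.mono_right (L.range_f_pow_le_span x (n + 1)) ?_
    have hdisj : Disjoint {b : L.B | W.d x b = n} {b : L.B | n + 1 ≤ W.d x b} :=
      Set.disjoint_left.2 fun b h h' => by
        simp only [Set.mem_ofPred_eq] at h h'
        omega
    refine (L.linIndep.disjoint_span_image hdisj).mono ?_ ?_ <;> refine Submodule.span_mono ?_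
    · rintro _ ⟨⟨b, hb, hd⟩, rfl⟩
      exact ⟨⟨b, hb⟩, hd, rfl⟩
    · rintro b ⟨hb, hd⟩
      exact ⟨⟨b, hb⟩, hd, rfl⟩
  · rw [L.range_f_pow_eq_span_sup x n, Submodule.map_sup, Submodule.map_span]
    simp
end
end

section
/- Let V be a weak lower perfect space with lower perfect basis B, and let 𝐢 = ((i_k,l_k))_{k≥1} be a good sequence of indices. For any b ∈ B and any finite sequence 𝐚 = (a_1, …, a_r) of nonnegative integers (extended by zeros to a good sequence), there exists c ∈ k^× such that 𝚏_{i_1l_1}^{a_1} ⋯ 𝚏_{i_rl_r}^{a_r}(b) − c·𝐟_{i_1l_1}^{a_1} ⋯ 𝐟_{i_rl_r}^{a_r}(b) ∈ V^{>𝐢,𝐚} (the term with the iterated 𝐟's being 0 if the iteration vanishes at some stage). -/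
noncomputable section

open Function Set

namespace BCDatum

variable {I P : Type*} [AddCommGroup P] (D : BCDatum I P)

theorem exists_wtOf_eq (x : D.Iinf) : ∃ i, ∃ l : ℕ, 0 < l ∧ D.wtOf x = l • D.α i := by
  rcases x with i | p
  · exact ⟨i.1, 1, one_pos, (one_smul ℕ _).symm⟩
  · exact ⟨p.1.1, p.2, p.2.pos, rfl⟩

theorem linearIndependent_nat : LinearIndependent ℕ D.α :=
  D.roots_indep.restrict_scalars fun m n h => by simpa using h

theorem exists_bound_nsmul_wtOf (x : D.Iinf) (μ : P) :
    ∃ N : ℕ, ∀ n : ℕ, ∀ β ∈ D.Rplus, n • D.wtOf x + β = μ → n ≤ N := by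
  obtain ⟨i, l, hl, hx⟩ := D.exists_wtOf_eq x
  have hcomb (n : ℕ) (c : I →₀ ℕ) : n • D.wtOf x + (c.sum fun i n => n • D.α i) =
      Finsupp.linearCombination ℕ D.α (Finsupp.single i (n * l) + c) := by
    rw [map_add, Finsupp.linearCombination_single, hx, mul_smul, Finsupp.linearCombination_apply]
  by_cases h : ∃ n : ℕ, ∃ β ∈ D.Rplus, n • D.wtOf x + β = μ
  · obtain ⟨m, _, ⟨c, rfl⟩, hm⟩ := h
    refine ⟨m * l + c i, ?_⟩
    rintro n _ ⟨c', rfl⟩ hn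
    have key := congrArg (· i) (D.linearIndependent_nat
      ((hcomb n c').symm.trans (hn.trans (hm.symm.trans (hcomb m c)))))
    simp only [Finsupp.add_apply, Finsupp.single_eq_same] at key
    have := Nat.le_mul_of_pos_right n hl
    omega
  · exact ⟨0, fun n β hβ hn => (h ⟨n, β, hβ, hn⟩).elim⟩

end BCDatum

namespace WeakLowerPerfect

variable {I P : Type*} [AddCommGroup P] {D : BCDatum I P}
  {k : Type*} [Field k] {V : Type*} [AddCommGroup V] [Module k V] (W : WeakLowerPerfect D k V)

theorem f_pow_wt (x : D.Iinf) (n : ℕ) {μ : P} {v : V} (hv : v ∈ W.wtSp μ) :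
    (W.f x ^ n) v ∈ W.wtSp (μ - n • D.wtOf x) := by
  induction n with
  | zero => simpa using hv
  | succ n ih =>
    rw [pow_succ', Module.End.mul_apply, succ_nsmul, ← sub_sub]
    exact W.f_wt x _ _ ih

theorem wtSp_ne_bot_of_mem_range {x : D.Iinf} {n : ℕ} {μ : P} {v : V} (hv : v ∈ W.wtSp μ)
    (hv0 : v ≠ 0) (h : v ∈ LinearMap.range (W.f x ^ n)) : W.wtSp (μ + n • D.wtOf x) ≠ ⊥ := by
  intro hbot
  obtain ⟨u, rfl⟩ := h
  have hle : (⨆ ν, W.wtSp ν) ≤ (⨆ ν, ⨆ (_ : ν ≠ μ), W.wtSp ν).comap (W.f x ^ n) := by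
    refine iSup_le fun ν w hw => ?_
    rw [Submodule.mem_comap]
    by_cases hν : ν - n • D.wtOf x = μ
    · rw [← hν, sub_add_cancel] at hbot
      rw [hbot, Submodule.mem_bot] at hw
      simp [hw]
    · exact Submodule.mem_iSup_of_mem _ (Submodule.mem_iSup_of_mem hν (W.f_pow_wt x n hw))
  rw [W.wt_total] at hle
  exact hv0 (Submodule.disjoint_def.1 (W.wt_indep μ) _ hv (hle Submodule.mem_top))

theorem bddAbove_mem_range_pow (x : D.Iinf) {μ : P} {v : V} (hv : v ∈ W.wtSp μ) (hv0 : v ≠ 0) :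
    BddAbove {n | v ∈ LinearMap.range (W.f x ^ n)} := by
  obtain ⟨Λ, hΛ⟩ := W.wt_bdd
  choose N hN using D.exists_bound_nsmul_wtOf x
  refine ⟨Λ.sup fun lam => N (lam - μ), fun n hn => ?_⟩
  obtain ⟨lam, hlam, β, hβ, h⟩ := hΛ _ (W.wtSp_ne_bot_of_mem_range hv hv0 hn)
  have hle : n ≤ N (lam - μ) := hN _ n β hβ (by
    rw [eq_sub_iff_add_eq] at h ⊢
    rw [← h]
    abel)
  exact hle.trans (Finset.le_sup (f := fun lam => N (lam - μ)) hlam)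

theorem range_f_pow_anti (x : D.Iinf) {m n : ℕ} (h : m ≤ n) :
    LinearMap.range (W.f x ^ n) ≤ LinearMap.range (W.f x ^ m) := by
  rintro _ ⟨u, rfl⟩
  exact ⟨(W.f x ^ (n - m)) u, by
    rw [← Module.End.mul_apply, ← pow_add, Nat.add_sub_cancel' h]⟩

theorem f_mem_range_pow_succ {x : D.Iinf} {n : ℕ} {v : V}
    (hv : v ∈ LinearMap.range (W.f x ^ n)) : W.f x v ∈ LinearMap.range (W.f x ^ (n + 1)) := by
  obtain ⟨u, rfl⟩ := hv
  exact ⟨u, by rw [pow_succ', Module.End.mul_apply]⟩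

theorem prodF_succ (gi : ℕ → D.Iinf) (a : ℕ → ℕ) (r : ℕ) :
    W.prodF gi a (r + 1) = W.prodF gi a r * W.f (gi r) ^ a r := by
  simp [prodF, List.range_succ]

theorem Vgt_succ (gi : ℕ → D.Iinf) (a : ℕ → ℕ) (r : ℕ) :
    W.Vgt gi a (r + 1) =
      LinearMap.range (W.prodF gi a r * W.f (gi r) ^ (a r + 1)) ⊔ W.Vgt gi a r := by
  simp only [Vgt, Finset.range_add_one, Finset.iSup_insert]

end WeakLowerPerfect

namespace LowerPerfectBasis

variable {I P : Type*} [AddCommGroup P] {D : BCDatum I P}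
  {k : Type*} [Field k] {V : Type*} [AddCommGroup V] [Module k V]
  {W : WeakLowerPerfect D k V} (L : LowerPerfectBasis W)

theorem le_d_of_mem_range (x : D.Iinf) {b : V} (hb : b ∈ L.B) {n : ℕ}
    (h : b ∈ LinearMap.range (W.f x ^ n)) : n ≤ W.d x b := by
  obtain ⟨μ, hμ⟩ := L.graded b hb
  exact le_csSup (W.bddAbove_mem_range_pow x hμ (L.linIndep.ne_zero ⟨b, hb⟩)) h

theorem floSeq_zero_right (gi : ℕ → D.Iinf) (a : ℕ → ℕ) (r : ℕ) : L.floSeq gi a r 0 = 0 := by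
  induction r with
  | zero => rfl
  | succ r ih =>
    change L.floSeq gi a r ((L.flo (gi r))^[a r] 0) = 0
    rw [Function.iterate_fixed (L.flo_zero _), ih]

theorem flo_iterate_mem (x : D.Iinf) {b : V} (hb : b ∈ L.B) (n : ℕ) :
    (L.flo x)^[n] b ∈ L.B ∨ (L.flo x)^[n] b = 0 := by
  induction n with
  | zero => exact Or.inl hb
  | succ n ih =>
    rw [Function.iterate_succ_apply']
    rcases ih with h | h
    · exact L.flo_mem x _ h
    · exact Or.inr (by rw [h, L.flo_zero])

theorem exists_f_pow_sub_flo_iterate_mem (x : D.Iinf) {b : V} (hb : b ∈ L.B) (n : ℕ) :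
    ∃ c : k, c ≠ 0 ∧
      (W.f x ^ n) b - c • (L.flo x)^[n] b ∈ LinearMap.range (W.f x ^ (n + 1)) := by
  induction n with
  | zero => exact ⟨1, one_ne_zero, by simp⟩
  | succ n ih =>
    obtain ⟨c, hc, h⟩ := ih
    have hf := W.f_mem_range_pow_succ h
    rw [map_sub, map_smul, ← Module.End.mul_apply, ← pow_succ'] at hf
    rw [Function.iterate_succ_apply']
    rcases L.flo_iterate_mem x hb n with hB | h0
    · have hmem : (L.flo x)^[n] b ∈ LinearMap.range (W.f x ^ n) := by
        have := Submodule.sub_mem _ (LinearMap.mem_range_self (W.f x ^ n) b)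
          (W.range_f_pow_anti x n.le_succ h)
        rwa [sub_sub_cancel, Submodule.smul_mem_iff _ hc] at this
      obtain ⟨c', hc', h'⟩ := L.flo_approx x _ hB
      have hd := L.le_d_of_mem_range x hB hmem
      refine ⟨c * c', mul_ne_zero hc hc', ?_⟩
      have := Submodule.add_mem _ hf (Submodule.smul_mem _ c
        (W.range_f_pow_anti x (by omega : n + 1 + 1 ≤ W.d x ((L.flo x)^[n] b) + 2) h'))
      rwa [smul_sub, sub_add_sub_cancel, smul_smul] at this
    · rw [h0, map_zero, smul_zero] at hf
      exact ⟨1, one_ne_zero, by rwa [h0, L.flo_zero, smul_zero]⟩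

theorem exists_prodF_sub_floSeq_mem (gi : ℕ → D.Iinf) (a : ℕ → ℕ) (r : ℕ) {b : V}
    (hb : b ∈ L.B) :
    ∃ c : k, c ≠ 0 ∧ W.prodF gi a r b - c • L.floSeq gi a r b ∈ W.Vgt gi a r := by
  induction r generalizing b with
  | zero => exact ⟨1, one_ne_zero, by simp [WeakLowerPerfect.prodF, floSeq]⟩
  | succ r ih =>
    obtain ⟨c, hc, u, hu⟩ := L.exists_f_pow_sub_flo_iterate_mem (gi r) hb (a r)
    have htop : W.prodF gi a (r + 1) b - c • W.prodF gi a r ((L.flo (gi r))^[a r] b) ∈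
        W.Vgt gi a (r + 1) := by
      rw [W.prodF_succ, Module.End.mul_apply, ← map_smul, ← map_sub, ← hu, W.Vgt_succ]
      exact Submodule.mem_sup_left ⟨u, rfl⟩
    change ∃ c : k, c ≠ 0 ∧ W.prodF gi a (r + 1) b -
      c • L.floSeq gi a r ((L.flo (gi r))^[a r] b) ∈ W.Vgt gi a (r + 1)
    rcases L.flo_iterate_mem (gi r) hb (a r) with hB | h0
    · obtain ⟨c', hc', h'⟩ := ih hB
      refine ⟨c * c', mul_ne_zero hc hc', ?_⟩
      have hle : W.Vgt gi a r ≤ W.Vgt gi a (r + 1) := W.Vgt_succ gi a r ▸ le_sup_right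
      have := Submodule.add_mem _ htop (Submodule.smul_mem _ c (hle h'))
      rwa [smul_sub, sub_add_sub_cancel, smul_smul] at this
    · rw [h0, map_zero, smul_zero] at htop
      exact ⟨1, one_ne_zero, by rwa [h0, L.floSeq_zero_right, smul_zero]⟩

end LowerPerfectBasis

/-- Proposition 7.8(a). For `b ∈ B` and `𝐚 = (a_1,…,a_r)` (extended by
zeros), there is `c ∈ k^×` with
`𝚏_{i_1l_1}^{a_1}⋯𝚏_{i_rl_r}^{a_r}(b) − c·𝐟_{i_1l_1}^{a_1}⋯𝐟_{i_rl_r}^{a_r}(b) ∈ V^{>𝐢,𝐚}`. -/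
theorem statement5 {I P : Type*} [AddCommGroup P] {D : BCDatum I P}
    {k V : Type*} [Field k] [AddCommGroup V] [Module k V]
    (W : WeakLowerPerfect D k V) (L : LowerPerfectBasis W)
    (gi : ℕ → D.Iinf) (hgi : GoodIdxSeq gi)
    (b : V) (hb : b ∈ L.B) (a : ℕ → ℕ) (r : ℕ) (ha : ∀ m, r ≤ m → a m = 0) :
    ∃ c : k, c ≠ 0 ∧
      W.prodF gi a r b - c • L.floSeq gi a r b ∈ W.Vgt gi a r :=
  L.exists_prodF_sub_floSeq_mem gi a r hb

end
end
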